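/- Let A₁, B₁ be multiplicative characters on F_q with A₁ ≠ B₁, and let x ∈ F_q with x ≠ 0. Then ₂F₁*(ε, A₁; B₁ | x) = 1 - B̄₁(x) · (A₁ choose B₁)⁻¹ · (Ā₁B₁)(1-x), where ε is the trivial character. -/

import Mathlib

/-- Multiplicative characters of a finite field with values in `ℂ` form a finite type. -/
noncomputable instance mulCharFintypeC (F : Type*) [Field F] [Fintype F] :
    Fintype (MulChar F ℂ) :=
  Fintype.ofFinite _

/-- The canonical additive character `θ(α) = ζ^{tr(α)}` of a finite field `F` of
characteristic `p`, where `ζ` is a fixed primitive `p`-th root of unity in `ℂ`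
and `tr` is the trace map to `ZMod p = F_p`. -/
noncomputable def addCharTheta (p : ℕ) (F : Type*) [Field F] [Fintype F]
    [Algebra (ZMod p) F] (zeta : ℂ) (a : F) : ℂ :=
  zeta ^ (Algebra.trace (ZMod p) F a).val

/-- The Gauss sum `g(χ) = ∑_{x ∈ F} χ(x) θ(x)`. -/
noncomputable def gaussS (p : ℕ) (F : Type*) [Field F] [Fintype F]
    [Algebra (ZMod p) F] (zeta : ℂ) (χ : MulChar F ℂ) : ℂ :=
  ∑ x : F, χ x * addCharTheta p F zeta x

/-- McCarthy's finite field hypergeometric function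
`₂F₁*(A₀, A₁; B₁ | x) = (1/(q-1)) ∑_χ [g(A₀χ)g(A₁χ)g((B₁χ)⁻¹)g(χ⁻¹)/(g(A₀)g(A₁)g(B₁⁻¹))] χ(x)`. -/
noncomputable def mcCarthy2F1 (p : ℕ) (F : Type*) [Field F] [Fintype F]
    [Algebra (ZMod p) F] (zeta : ℂ) (A₀ A₁ B₁ : MulChar F ℂ) (x : F) : ℂ :=
  (1 / ((Fintype.card F : ℂ) - 1)) * ∑ χ : MulChar F ℂ,
    gaussS p F zeta (A₀ * χ) * gaussS p F zeta (A₁ * χ) * gaussS p F zeta (B₁ * χ)⁻¹ *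
      gaussS p F zeta χ⁻¹ /
        (gaussS p F zeta A₀ * gaussS p F zeta A₁ * gaussS p F zeta B₁⁻¹) * χ x

/-- The finite field Appell function `F₄*(A; B; C, C'; x, y)`. -/
noncomputable def appellF4star (p : ℕ) (F : Type*) [Field F] [Fintype F]
    [Algebra (ZMod p) F] (zeta : ℂ) (A B C C' : MulChar F ℂ) (x y : F) : ℂ :=
  (1 / ((Fintype.card F : ℂ) - 1) ^ 2) * ∑ ψ : MulChar F ℂ, ∑ χ : MulChar F ℂ,
    gaussS p F zeta (A * χ * ψ) * gaussS p F zeta (B * χ * ψ) * gaussS p F zeta (C * ψ)⁻¹ *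
      gaussS p F zeta (C' * χ)⁻¹ * gaussS p F zeta ψ⁻¹ * gaussS p F zeta χ⁻¹ /
        (gaussS p F zeta A * gaussS p F zeta B * gaussS p F zeta C⁻¹ *
          gaussS p F zeta C'⁻¹) *
      (ψ x * χ y)

/-- The finite field Appell function `F₁*(A; B, B'; C; x, y)`. -/
noncomputable def appellF1star (p : ℕ) (F : Type*) [Field F] [Fintype F]
    [Algebra (ZMod p) F] (zeta : ℂ) (A B B' C : MulChar F ℂ) (x y : F) : ℂ :=
  (1 / ((Fintype.card F : ℂ) - 1) ^ 2) * ∑ ψ : MulChar F ℂ, ∑ χ : MulChar F ℂ,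
    gaussS p F zeta (A * χ * ψ) * gaussS p F zeta (B * ψ) * gaussS p F zeta (B' * χ) *
      gaussS p F zeta (C * χ * ψ)⁻¹ * gaussS p F zeta ψ⁻¹ * gaussS p F zeta χ⁻¹ /
        (gaussS p F zeta A * gaussS p F zeta B * gaussS p F zeta B' *
          gaussS p F zeta C⁻¹) *
      (ψ x * χ y)

/-- The Jacobi sum `J(A,B) = ∑_{x ∈ F} A(x) B(1-x)`. -/
noncomputable def jacobiS (F : Type*) [Field F] [Fintype F] (A B : MulChar F ℂ) : ℂ :=
  ∑ x : F, A x * B (1 - x)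

/-- Greene's binomial coefficient `(A choose B) = (B(-1)/q) J(A, B⁻¹)`. -/
noncomputable def binomChar (F : Type*) [Field F] [Fintype F] (A B : MulChar F ℂ) : ℂ :=
  (B (-1) / (Fintype.card F : ℂ)) * jacobiS F A B⁻¹

/-- Orthogonality of the multiplicative characters of a finite field. -/
theorem sum_mulChar_apply (F : Type*) [Field F] [Fintype F] [DecidableEq F] (a : F) :
    ∑ χ : MulChar F ℂ, χ a = if a = 1 then (Fintype.card F : ℂ) - 1 else 0 := by
  split_ifs with ha
  · subst ha
    simp only [map_one, Finset.sum_const, Finset.card_univ, nsmul_eq_mul, mul_one]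
    rw [← Nat.card_eq_fintype_card, MulChar.card_eq_card_units_of_hasEnoughRootsOfUnity,
      Nat.card_eq_fintype_card, Fintype.card_units, Nat.cast_sub Fintype.card_pos, Nat.cast_one]
  · obtain ⟨χ₀, h₀⟩ := MulChar.exists_apply_ne_one_of_hasEnoughRootsOfUnity F ℂ ha
    refine eq_zero_of_mul_eq_self_left h₀ ?_
    rw [Finset.mul_sum]
    simp_rw [← MulChar.mul_apply]
    exact Fintype.sum_equiv (Equiv.mulLeft χ₀) _ _ fun χ ↦ rfl

/-- The additive character `addCharTheta` is a primitive `AddChar`. -/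
theorem exists_isPrimitive_eq_addCharTheta (p : ℕ) [Fact p.Prime] (F : Type*) [Field F]
    [Fintype F] [Algebra (ZMod p) F] {zeta : ℂ} (hzeta : IsPrimitiveRoot zeta p) :
    ∃ ψ : AddChar F ℂ, ψ.IsPrimitive ∧ ∀ a, ψ a = addCharTheta p F zeta a := by
  refine ⟨(AddChar.zmodChar p hzeta.pow_eq_one).compAddMonoidHom
    (Algebra.trace (ZMod p) F).toAddMonoidHom, AddChar.IsPrimitive.of_ne_one fun h ↦ ?_,
    fun a ↦ AddChar.zmodChar_apply hzeta.pow_eq_one _⟩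
  obtain ⟨a, ha⟩ := Algebra.trace_surjective (ZMod p) F 1
  have h1 : AddChar.zmodChar p hzeta.pow_eq_one (Algebra.trace (ZMod p) F a) = 1 :=
    DFunLike.congr_fun h a
  have hp := (Fact.out : p.Prime).one_lt
  have : Fact (1 < p) := ⟨hp⟩
  rw [ha, AddChar.zmodChar_apply, ZMod.val_one, pow_one] at h1
  exact hzeta.ne_one hp h1

section

variable {F : Type*} [Field F] [Fintype F] {ψ : AddChar F ℂ}

theorem gaussSum_ne_zero (hψ : ψ.IsPrimitive) (χ : MulChar F ℂ) : gaussSum χ ψ ≠ 0 := by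
  rcases eq_or_ne χ 1 with rfl | hχ
  · rw [gaussSum_one_left (by simpa using hψ one_ne_zero)]
    exact neg_ne_zero.mpr one_ne_zero
  · exact gaussSum_ne_zero_of_nontrivial (Nat.cast_ne_zero.mpr Fintype.card_ne_zero) hχ hψ

theorem gaussSum_mul_gaussSum_inv [DecidableEq (MulChar F ℂ)] (hψ : ψ.IsPrimitive)
    (χ : MulChar F ℂ) :
    gaussSum χ ψ * gaussSum χ⁻¹ ψ =
      χ (-1) * Fintype.card F - if χ = 1 then (Fintype.card F : ℂ) - 1 else 0 := by
  split_ifs with hχ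
  · subst hχ
    rw [inv_one, gaussSum_one_left (by simpa using hψ one_ne_zero),
      MulChar.one_apply isUnit_one.neg]
    ring
  · rw [← mul_gaussSum_inv_eq_gaussSum χ⁻¹ ψ, mul_left_comm,
      gaussSum_mul_gaussSum_eq_card hχ hψ, MulChar.inv_apply', inv_neg_one, sub_zero]

/-- A Fourier-type expansion of a product of two Gauss sums over all twists. -/
theorem sum_apply_mul_gaussSum_mul_gaussSum (A B : MulChar F ℂ) (ψ : AddChar F ℂ) {y : F}
    (hy : y ≠ 0) :
    ∑ χ : MulChar F ℂ, χ y * (gaussSum (A * χ) ψ * gaussSum (B * χ)⁻¹ ψ) =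
      ((Fintype.card F : ℂ) - 1) * (A⁻¹ y * gaussSum (A * B⁻¹) (ψ.mulShift (1 + y⁻¹))) := by
  classical
  have hexp (χ : MulChar F ℂ) : χ y * (gaussSum (A * χ) ψ * gaussSum (B * χ)⁻¹ ψ) =
      ∑ v, ∑ u, A u * B⁻¹ v * ψ (u + v) * χ (y * u * v⁻¹) := by
    simp only [gaussSum]
    rw [mul_comm (∑ a, (A * χ) a * ψ a), Finset.sum_mul_sum, Finset.mul_sum]
    refine Finset.sum_congr rfl fun v _ ↦ ?_
    rw [Finset.mul_sum]
    refine Finset.sum_congr rfl fun u _ ↦ ?_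
    simp only [mul_inv, MulChar.mul_apply, map_mul, MulChar.inv_apply', AddChar.map_add_eq_mul]
    ring
  simp_rw [hexp]
  rw [Finset.sum_comm, gaussSum, Finset.mul_sum, Finset.mul_sum]
  refine Finset.sum_congr rfl fun v _ ↦ ?_
  rw [Finset.sum_comm]
  simp_rw [← Finset.mul_sum, sum_mulChar_apply]
  rcases eq_or_ne v 0 with rfl | hv
  · simp [MulChar.map_zero]
  · have hiff (u : F) : y * u * v⁻¹ = 1 ↔ u = y⁻¹ * v := by
      rw [← div_eq_mul_inv, div_eq_one_iff_eq hv, eq_inv_mul_iff_mul_eq₀ hy]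
    simp only [hiff, mul_ite, mul_zero, Finset.sum_ite_eq', Finset.mem_univ, if_true,
      AddChar.mulShift_apply, MulChar.mul_apply, map_mul, MulChar.inv_apply']
    rw [show y⁻¹ * v + v = (1 + y⁻¹) * v by ring]
    ring

theorem gaussSum_mulShift_of_ne_one {χ : MulChar F ℂ} (hχ : χ ≠ 1) (ψ : AddChar F ℂ) (a : F) :
    gaussSum χ (ψ.mulShift a) = χ⁻¹ a * gaussSum χ ψ := by
  rcases eq_or_ne a 0 with rfl | ha
  · rw [AddChar.mulShift_zero, gaussSum_one_right hχ, MulChar.map_zero, zero_mul]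
  · exact gaussSum_mulShift_eq χ ψ (Units.mk0 a ha)

end

theorem mulChar_apply_neg_one_mul_self {F : Type*} [Field F] (χ : MulChar F ℂ) :
    χ (-1) * χ (-1) = 1 := by
  rw [← map_mul, neg_one_mul, neg_neg, map_one]

theorem stmt6    (p : ℕ) [Fact p.Prime] (hp : p ≠ 2) (F : Type*) [Field F] [Fintype F]
    [Algebra (ZMod p) F] (zeta : ℂ) (hzeta : IsPrimitiveRoot zeta p)
    (A₁ B₁ : MulChar F ℂ) (hAB : A₁ ≠ B₁) (x : F) (hx0 : x ≠ 0) :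
    mcCarthy2F1 p F zeta 1 A₁ B₁ x =
    1 - B₁⁻¹ x * (binomChar F A₁ B₁)⁻¹ * (A₁⁻¹ * B₁) (1 - x) := by
  classical
  obtain ⟨ψ, hψ, hθ⟩ := exists_isPrimitive_eq_addCharTheta p F hzeta
  have hg (χ : MulChar F ℂ) : gaussS p F zeta χ = gaussSum χ ψ := by
    simp only [gaussS, gaussSum, hθ]
  have hAB' : A₁ * B₁⁻¹ ≠ 1 := by rwa [Ne, mul_inv_eq_one]
  have hJ : jacobiS F A₁ B₁⁻¹ =
      gaussSum A₁ ψ * gaussSum B₁⁻¹ ψ / gaussSum (A₁ * B₁⁻¹) ψ :=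
    jacobiSum_eq_gaussSum_mul_gaussSum_div_gaussSum
      (Nat.cast_ne_zero.mpr Fintype.card_ne_zero) hAB' hψ
  have hA := gaussSum_ne_zero hψ A₁
  have hB := gaussSum_ne_zero hψ B₁⁻¹
  have hG := gaussSum_ne_zero hψ (A₁ * B₁⁻¹)
  have hq : (Fintype.card F : ℂ) ≠ 0 := Nat.cast_ne_zero.mpr Fintype.card_ne_zero
  have hq1 : (Fintype.card F : ℂ) - 1 ≠ 0 :=
    sub_ne_zero.mpr (Nat.cast_ne_one.mpr Fintype.one_lt_card.ne')
  have hsum := sum_apply_mul_gaussSum_mul_gaussSum A₁ B₁ ψ (neg_ne_zero.mpr hx0)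
  have hterm (χ : MulChar F ℂ) :
      gaussSum (1 * χ) ψ * gaussSum (A₁ * χ) ψ * gaussSum (B₁ * χ)⁻¹ ψ * gaussSum χ⁻¹ ψ /
        (gaussSum 1 ψ * gaussSum A₁ ψ * gaussSum B₁⁻¹ ψ) * χ x =
      (if χ = 1 then (Fintype.card F : ℂ) - 1 else 0) -
        Fintype.card F / (gaussSum A₁ ψ * gaussSum B₁⁻¹ ψ) *
          (χ (-x) * (gaussSum (A₁ * χ) ψ * gaussSum (B₁ * χ)⁻¹ ψ)) := by
    have h := gaussSum_mul_gaussSum_inv hψ χ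
    rw [one_mul, gaussSum_one_left (by simpa using hψ one_ne_zero),
      show gaussSum χ ψ * gaussSum (A₁ * χ) ψ * gaussSum (B₁ * χ)⁻¹ ψ * gaussSum χ⁻¹ ψ =
        (gaussSum χ ψ * gaussSum χ⁻¹ ψ) * (gaussSum (A₁ * χ) ψ * gaussSum (B₁ * χ)⁻¹ ψ) by ring,
      h, ← neg_one_mul x, map_mul]
    split_ifs with hχ
    · subst hχ
      rw [MulChar.one_apply hx0.isUnit, mul_one, mul_one]
      field_simp
      ring_nf
    · field_simp
      ring
  have hshift : A₁⁻¹ (-x) * gaussSum (A₁ * B₁⁻¹) (ψ.mulShift (1 + (-x)⁻¹)) =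
      B₁ (-1) * B₁⁻¹ x * (A₁⁻¹ * B₁) (1 - x) * gaussSum (A₁ * B₁⁻¹) ψ := by
    rw [gaussSum_mulShift_of_ne_one hAB', mul_inv, inv_inv,
      show 1 + (-x)⁻¹ = (-x)⁻¹ * (1 - x) by grind, map_mul, ← mul_assoc, ← mul_assoc]
    congr 2
    have hinv : (-x)⁻¹ = -1 * x⁻¹ := by field_simp
    simp only [MulChar.mul_apply, MulChar.inv_apply', inv_inv]
    rw [← mul_assoc, ← map_mul, inv_mul_cancel₀ (neg_ne_zero.mpr hx0), map_one, one_mul, hinv,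
      map_mul]
  simp only [mcCarthy2F1, hg, hterm, binomChar, hJ]
  rw [Finset.sum_sub_distrib, ← Finset.mul_sum, hsum, hshift, Finset.sum_ite_eq',
    if_pos (Finset.mem_univ _)]
  have hB2 : (B₁ (-1))⁻¹ = B₁ (-1) :=
    inv_eq_of_mul_eq_one_left (mulChar_apply_neg_one_mul_self B₁)
  rw [mul_inv, div_eq_mul_inv (B₁ (-1)), mul_inv, hB2]
  field_simp
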